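/- Let n ≥ 2 be an integer, let X be a complex Banach space of dimension greater than 1, and let 𝒜 be a subalgebra of the algebra B(X) of all bounded linear operators on X that contains the identity operator and all bounded finite-rank operators (a standard operator algebra). Then every multiplicative generalized Jordan n-derivation Δ : 𝒜 → 𝒜 can be expressed as Δ(t) = μt + δ(t) for all t ∈ 𝒜, where μ lies in the center Z(𝒜) and δ : 𝒜 → 𝒜 is a derivation. -/

import Mathlib

/-- The Jordan `n`-product `qₙ(t₁,…,tₙ)`, folding the Jordan product `a∘b = ab + ba`
from the left: `q₁(t₁) = t₁`, `qₙ(t₁,…,tₙ) = qₙ₋₁(t₁,…,tₙ₋₁)∘tₙ`. -/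
def jordanProd {A : Type*} [Ring A] : List A → A
  | [] => 0
  | t :: ts => ts.foldl (fun x y => x * y + y * x) t

/-- A map `δ` (not assumed additive) is a multiplicative Jordan `n`-derivation if
`δ(qₙ(t₁,…,tₙ)) = Σᵢ qₙ(t₁,…,δ(tᵢ),…,tₙ)` for all `t₁,…,tₙ`. -/
def IsMulJordanDeriv {A : Type*} [Ring A] (n : ℕ) (δ : A → A) : Prop :=
  ∀ l : List A, l.length = n →
    δ (jordanProd l) = ∑ i ∈ Finset.range n, jordanProd (l.set i (δ (l.getD i 0)))

/-- A map `Δ` is a multiplicative generalized Jordan `n`-derivation (with associated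
multiplicative Jordan `n`-derivation `δ`). -/
def IsMulGenJordanDeriv {A : Type*} [Ring A] (n : ℕ) (Δ δ : A → A) : Prop :=
  ∀ l : List A, l.length = n →
    Δ (jordanProd l) = jordanProd (l.set 0 (Δ (l.getD 0 0)))
      + ∑ i ∈ Finset.Ico 1 n, jordanProd (l.set i (δ (l.getD i 0)))

set_option synthInstance.maxHeartbeats 1000000
set_option maxHeartbeats 2000000

section PrimeRing

variable {A : Type*} [Ring A]

/-- Primeness of a ring, stated elementwise. -/
def ElementwisePrime (A : Type*) [Ring A] : Prop :=
  ∀ a b : A, (∀ x, a * x * b = 0) → a = 0 ∨ b = 0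

/-- The off-diagonal Peirce part of `x` with respect to `p`. -/
def offDiag (p x : A) : A := p * x * (1 - p) + (1 - p) * x * p

variable {p : A}

lemma offDiag_mem (hp : p * p = p) (a : A) : p * offDiag p a + offDiag p a * p = offDiag p a := by
  have h (x : A) : p * (p * x) = p * x := by rw [← mul_assoc, hp]
  simp only [offDiag, mul_sub, sub_mul, mul_one, one_mul, mul_assoc, hp, mul_add,
    add_mul, h]
  abel

lemma offDiag_of_mem (hp : p * p = p) {a : A} (ha : p * a + a * p = a) : offDiag p a = a := by
  have h (x : A) : p * (p * x) = p * x := by rw [← mul_assoc, hp]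
  have h1 : p * (a * p) = 0 := by
    have := congrArg (p * ·) ha
    simpa [mul_add, h] using this
  simp only [offDiag, mul_sub, sub_mul, mul_one, one_mul, mul_assoc, h1]
  rw [sub_zero, sub_zero, ha]

lemma offDiag_add (p a b : A) : offDiag p (a + b) = offDiag p a + offDiag p b := by
  simp only [offDiag, mul_add, add_mul]; abel

lemma offDiag_corner {a : A} (h1 : p * a = a) (h2 : a * p = a) : offDiag p a = 0 := by
  simp only [offDiag, sub_mul, mul_sub, h1, h2, mul_one, one_mul]; abel

lemma mem_offDiag_compl {m : A} (hm : p * m + m * p = m) :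
    (1 - p) * m + m * (1 - p) = m := by
  rw [sub_mul, mul_sub, one_mul, mul_one]
  conv_rhs => rw [show m = m + m - (p * m + m * p) by rw [hm]; abel]
  abel

/-- In a prime algebra with a nontrivial idempotent, an element commuting with all idempotents
is central. -/
lemma ElementwisePrime.mul_comm_of_idem {z : A} (hprime : ElementwisePrime A)
    (hp : p * p = p) (hp0 : p ≠ 0) (hp1 : p ≠ 1) (hz : ∀ e : A, e * e = e → e * z = z * e)
    (a : A) : z * a = a * z := by
  have off {p : A} (hp : p * p = p) (x : A) :
      z * (p * x * (1 - p)) = p * x * (1 - p) * z := by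
    have h (x : A) : p * (p * x) = p * x := by rw [← mul_assoc, hp]
    have h1 := hz (p + p * x * (1 - p)) (by
      simp only [mul_sub, sub_mul, add_mul, mul_add, mul_one, mul_assoc, hp, h]; abel)
    rw [add_mul, mul_add, hz p hp] at h1
    exact (add_left_cancel h1).symm
  have diag {p : A} (hp : p * p = p) (hp1 : p ≠ 1) (x : A) :
      z * (p * x * p) = p * x * p * z := by
    rw [← sub_eq_zero]
    refine (hprime _ (1 - p) fun y => ?_).resolve_right (sub_ne_zero.2 hp1.symm)
    have e1 := off hp (x * p * y)
    have e2 := off hp y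
    have e3 := hz p hp
    have e4 : p * x * p * z * y * (1 - p) = p * x * (z * (p * y * (1 - p))) := by
      rw [mul_assoc (p * x) p z, e3]; simp only [mul_assoc]
    rw [sub_mul, sub_mul, e4, e2]
    simp only [mul_assoc] at e1 ⊢
    rw [e1, sub_self]
  have hqq : (1 - p) * (1 - p) = 1 - p := IsIdempotentElem.one_sub hp
  have h1 := off hp a
  have h2 := off hqq a
  have h3 := diag hp hp1 a
  have h4 := diag hqq (by simpa) a
  rw [sub_sub_cancel] at h2
  have h5 : a = p * a * p + p * a * (1 - p) + ((1 - p) * a * p + (1 - p) * a * (1 - p)) := by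
    noncomm_ring
  rw [h5]
  simp only [mul_add z, add_mul _ _ z, h1, h2, h3, h4]

end PrimeRing

/-- A subgroup-union argument: if at every point one of two additive maps vanishes, then one
of them vanishes identically. -/
lemma forall_or_forall_of_add {B C D : Type*} [AddGroup B] [AddGroup C] [AddGroup D]
    (f : B → C) (g : B → D) (hf : ∀ x y, f (x + y) = f x + f y)
    (hg : ∀ x y, g (x + y) = g x + g y) (h : ∀ x, f x = 0 ∨ g x = 0) :
    (∀ x, f x = 0) ∨ (∀ x, g x = 0) := by
  by_contra! hc
  obtain ⟨⟨x, hx⟩, ⟨y, hy⟩⟩ := hc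
  have hgx := (h x).resolve_left hx
  have hfy := (h y).resolve_right hy
  rcases h (x + y) with h1 | h1
  · rw [hf, hfy, add_zero] at h1; exact hx h1
  · rw [hg, hgx, zero_add] at h1; exact hy h1

section PrimeAlgebra

variable {A : Type*} [Ring A] [Algebra ℂ A]

/-- The normalised Jordan product `(xy + yx) / 2`. -/
noncomputable def halfJordan (x y : A) : A := (2⁻¹ : ℂ) • (x * y + y * x)

/-- Derivability with respect to the normalised Jordan product; no additivity is assumed. -/
def IsHalfJordanDeriv (d : A → A) : Prop :=
  ∀ x y, d (halfJordan x y) = halfJordan (d x) y + halfJordan x (d y)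

lemma halfJordan_sub_one (p x : A) : halfJordan (1 - p) x = x - halfJordan p x := by
  simp only [halfJordan, sub_mul, mul_sub, mul_one, one_mul]; module

lemma halfJordan_zero (x : A) : halfJordan x 0 = 0 := by simp [halfJordan]

lemma zero_halfJordan (x : A) : halfJordan 0 x = 0 := by simp [halfJordan]

lemma IsHalfJordanDeriv.map_zero {d : A → A} (hd : IsHalfJordanDeriv d) : d 0 = 0 := by
  have h := hd 0 0
  simpa [halfJordan_zero, zero_halfJordan] using h

lemma eq_zero_of_halfJordan_offDiag {p y : A} (hprime : ElementwisePrime A)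
    (hp : p * p = p) (hp1 : p ≠ 1) (h1 : p * y = y) (h2 : y * p = y)
    (h : ∀ t : A, p * t + t * p = t → halfJordan t y = 0) : y = 0 := by
  refine (hprime y (1 - p) fun x => ?_).resolve_right (sub_ne_zero.2 hp1.symm)
  have h3 := h (p * x * (1 - p)) (by
    simp only [mul_sub, sub_mul, mul_one, mul_assoc, hp]; simp only [← mul_assoc, hp]; abel)
  have h4 : p * x * (1 - p) * y = 0 := by rw [mul_assoc, sub_mul, one_mul, h1, sub_self, mul_zero]
  have h5 : y * (p * x * (1 - p)) = y * x * (1 - p) := by simp only [← mul_assoc, h2]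
  rw [halfJordan, h4, h5, zero_add] at h3
  simpa using h3

section Normalised

variable {d : A → A} {p : A}

lemma offDiag_eq_halfJordan (hp : p * p = p) (a : A) :
    (2⁻¹ : ℂ) • (2⁻¹ : ℂ) • offDiag p a = halfJordan p (halfJordan (1 - p) a) := by
  have h (x : A) : p * (p * x) = p * x := by rw [← mul_assoc, hp]
  simp only [offDiag, halfJordan, mul_sub, sub_mul, mul_one, one_mul, mul_assoc, hp, mul_add,
    add_mul, smul_mul_assoc, mul_smul_comm, h]
  module

lemma map_halfJordan_idem (hd : IsHalfJordanDeriv d) (hdp : d p = 0) (a : A) :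
    d (halfJordan p a) = halfJordan p (d a) := by
  rw [hd, hdp, zero_halfJordan, zero_add]

lemma halfJordan_of_mem {m : A} (hm : p * m + m * p = m) : halfJordan p m = (2⁻¹ : ℂ) • m := by
  rw [halfJordan, hm]

lemma map_mem_offDiag (hd : IsHalfJordanDeriv d) (hdp : d p = 0)
    (hdq : d (1 - p) = 0) {m : A} (hm : p * m + m * p = m) : p * d m + d m * p = d m := by
  have h1 := map_halfJordan_idem hd hdp m
  have h2 := map_halfJordan_idem hd hdq m
  rw [halfJordan_sub_one, halfJordan_sub_one, halfJordan_of_mem hm,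
    show m - (2⁻¹ : ℂ) • m = (2⁻¹ : ℂ) • m by module] at h2
  rw [halfJordan_of_mem hm, h2] at h1
  have h3 : d m = (2 : ℂ) • halfJordan p (d m) := by
    linear_combination (norm := module) h1
  rw [halfJordan, smul_smul] at h3
  simpa using h3.symm

lemma map_half_smul (hd : IsHalfJordanDeriv d) (hdp : d p = 0)
    (hdq : d (1 - p) = 0) {m : A} (hm : p * m + m * p = m) :
    d ((2⁻¹ : ℂ) • m) = (2⁻¹ : ℂ) • d m := by
  rw [← halfJordan_of_mem hm, map_halfJordan_idem hd hdp,
    halfJordan_of_mem (map_mem_offDiag hd hdp hdq hm)]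

lemma smul_mem_offDiag {m : A} (c : ℂ) (hm : p * m + m * p = m) :
    p * (c • m) + (c • m) * p = c • m := by
  rw [mul_smul_comm, smul_mul_assoc, ← smul_add, hm]

lemma map_offDiag (hd : IsHalfJordanDeriv d) (hp : p * p = p) (hdp : d p = 0)
    (hdq : d (1 - p) = 0) (a : A) : d (offDiag p a) = offDiag p (d a) := by
  have hm := offDiag_mem hp a
  have h := map_halfJordan_idem hd hdp (halfJordan (1 - p) a)
  rw [map_halfJordan_idem hd hdq, ← offDiag_eq_halfJordan hp, ← offDiag_eq_halfJordan hp,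
    map_half_smul hd hdp hdq (smul_mem_offDiag _ hm), map_half_smul hd hdp hdq hm] at h
  have h2 : (2⁻¹ : ℂ) ≠ 0 := by norm_num
  exact smul_right_injective A h2 (smul_right_injective A h2 h)

lemma map_corner (hd : IsHalfJordanDeriv d) (hp : p * p = p) (hdp : d p = 0)
    {a : A} (h1 : p * a = a) (h2 : a * p = a) : p * d a = d a ∧ d a * p = d a := by
  have h := map_halfJordan_idem hd hdp a
  rw [halfJordan, h1, h2, show (2⁻¹ : ℂ) • (a + a) = a by module, halfJordan] at h
  have hs : p * d a + d a * p = d a + d a := by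
    have := congrArg ((2 : ℂ) • ·) h
    simp only [smul_smul] at this
    norm_num at this
    rw [← this]; module
  have e1 : p * d a * p = d a * p := by
    have := congrArg (· * p) hs
    simp only [add_mul, mul_assoc, hp] at this
    rw [mul_assoc]; exact add_right_cancel this
  have e2 : p * d a * p = p * d a := by
    have := congrArg (p * ·) hs
    simp only [mul_add, ← mul_assoc, hp] at this
    exact add_left_cancel this
  have e3 : p * d a = d a * p := e2.symm.trans e1
  have e4 : d a * p = d a := by
    rw [e3] at hs
    have := congrArg ((2⁻¹ : ℂ) • ·) hs
    simp only [← two_smul ℂ, smul_smul] at this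
    norm_num at this
    exact this
  exact ⟨e3.trans e4, e4⟩

lemma halfJordan_add (x a b : A) : halfJordan x (a + b) = halfJordan x a + halfJordan x b := by
  simp only [halfJordan, mul_add, add_mul]; module

lemma add_halfJordan (x a b : A) : halfJordan (a + b) x = halfJordan a x + halfJordan b x := by
  simp only [halfJordan, mul_add, add_mul]; module

lemma offDiag_halfJordan_mem (hp : p * p = p) {s t : A} (hs : p * s + s * p = s)
    (ht : p * t + t * p = t) : offDiag p (halfJordan s t) = 0 := by
  have k {s t : A} (hs : p * s + s * p = s) (ht : p * t + t * p = t) :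
      p * (s * t) = s * t * p := by
    have e1 : p * s = s - s * p := eq_sub_of_add_eq hs
    have e2 : p * t = t - t * p := eq_sub_of_add_eq ht
    rw [← mul_assoc, e1, sub_mul, mul_assoc s p t, e2, mul_sub, mul_assoc]; abel
  have k1 := k hs ht
  have k2 := k ht hs
  have k3 : p * halfJordan s t = halfJordan s t * p := by
    rw [halfJordan, mul_smul_comm, smul_mul_assoc, mul_add, add_mul, k1, k2]
  simp only [offDiag, sub_mul, mul_sub, mul_one, one_mul, k3, mul_assoc, hp]; abel

lemma halfJordan_corner_mem {a t : A} (hp : p * p = p) (h1 : p * a = a) (h2 : a * p = a)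
    (ht : p * t + t * p = t) : offDiag p (halfJordan t a) = halfJordan t a := by
  apply offDiag_of_mem hp
  have h (x : A) : p * (a * x) = a * x := by rw [← mul_assoc, h1]
  have e1 : p * t = t - t * p := eq_sub_of_add_eq ht
  have e2 : p * t * a = 0 := by rw [e1, sub_mul, mul_assoc, h1, sub_self]
  have e3 : a * t * p = 0 := by
    have : t * p = t - p * t := eq_sub_of_add_eq' ht
    rw [mul_assoc, this, mul_sub, ← mul_assoc, h2, sub_self]
  simp only [halfJordan, mul_smul_comm, smul_mul_assoc, mul_add, add_mul, h, ← smul_add]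
  rw [← mul_assoc, e2, e3, mul_assoc, h2]; simp [add_comm]

lemma map_corner_add_offDiag (hprime : ElementwisePrime A) (hd : IsHalfJordanDeriv d)
    (hp : p * p = p) (hp1 : p ≠ 1) (hdp : d p = 0) (hdq : d (1 - p) = 0) {a m : A}
    (h1 : p * a = a) (h2 : a * p = a) (hm : p * m + m * p = m) :
    d (a + m) = d a + d m := by
  obtain ⟨k1, k2⟩ := map_corner hd hp hdp h1 h2
  have hM : offDiag p (d (a + m)) = d m := by
    rw [← map_offDiag hd hp hdp hdq, offDiag_add, offDiag_corner h1 h2, offDiag_of_mem hp hm,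
      zero_add]
  have hq : (1 - p) * d (a + m) * (1 - p) = 0 := by
    have e : a + m = halfJordan p (a + (2 : ℂ) • m) := by
      rw [halfJordan_add, halfJordan_of_mem (smul_mem_offDiag 2 hm), halfJordan, h1, h2]
      module
    rw [e, map_halfJordan_idem hd hdp, halfJordan]
    have e1 : (1 - p) * p = 0 := by rw [sub_mul, hp, one_mul, sub_self]
    have e2 : p * (1 - p) = 0 := by rw [mul_sub, hp, mul_one, sub_self]
    rw [mul_smul_comm, smul_mul_assoc, mul_add, add_mul, ← mul_assoc, e1, mul_assoc, mul_assoc,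
      mul_assoc _ p, e2]
    simp
  have hdec : d (a + m) = p * d (a + m) * p + d m := by
    have : d (a + m) = p * d (a + m) * p + offDiag p (d (a + m))
      + (1 - p) * d (a + m) * (1 - p) := by rw [offDiag]; noncomm_ring
    rwa [hM, hq, add_zero] at this
  set b := p * d (a + m) * p with hb
  have b1 : p * b = b := by rw [hb, mul_assoc, ← mul_assoc p p, hp]
  have b2 : b * p = b := by rw [hb, mul_assoc, hp]
  have hy : b - d a = 0 := by
    refine eq_zero_of_halfJordan_offDiag hprime hp hp1 (by rw [mul_sub, b1, k1])
      (by rw [sub_mul, b2, k2]) fun t ht => ?_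
    have hdt := map_mem_offDiag hd hdp hdq ht
    have hdm := map_mem_offDiag hd hdp hdq hm
    have e1 := map_offDiag hd hp hdp hdq (halfJordan t (a + m))
    rw [hd, halfJordan_add, hdec, halfJordan_add, halfJordan_add] at e1
    simp only [offDiag_add, offDiag_halfJordan_mem hp ht hm, offDiag_halfJordan_mem hp hdt hm,
      offDiag_halfJordan_mem hp ht hdm, halfJordan_corner_mem hp h1 h2 ht,
      halfJordan_corner_mem hp h1 h2 hdt, halfJordan_corner_mem hp b1 b2 ht, add_zero] at e1
    rw [hd] at e1
    have e2 := add_left_cancel e1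
    rw [show b = (b - d a) + d a by abel, halfJordan_add] at e2
    simpa using e2
  rw [hdec, sub_eq_zero.1 hy]

lemma map_half_decomp (hprime : ElementwisePrime A) (hd : IsHalfJordanDeriv d)
    (hp : p * p = p) (hp1 : p ≠ 1) (hdp : d p = 0) (hdq : d (1 - p) = 0) (a : A) :
    halfJordan p (d a) = d (p * a * p) + (2⁻¹ : ℂ) • d (offDiag p a) := by
  have hm := offDiag_mem hp a
  rw [← map_half_smul hd hdp hdq hm, ← map_corner_add_offDiag hprime hd hp hp1 hdp hdq
    (by rw [mul_assoc, ← mul_assoc p p, hp]) (by rw [mul_assoc, hp]) (smul_mem_offDiag _ hm),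
    ← map_halfJordan_idem hd hdp]
  congr 1
  simp only [halfJordan, offDiag, mul_sub, sub_mul, one_mul, mul_one, mul_assoc]
  module

lemma map_peirce (hprime : ElementwisePrime A) (hd : IsHalfJordanDeriv d)
    (hp : p * p = p) (hp0 : p ≠ 0) (hp1 : p ≠ 1) (hdp : d p = 0) (hdq : d (1 - p) = 0) (a : A) :
    d a = d (p * a * p) + d (offDiag p a) + d ((1 - p) * a * (1 - p)) := by
  have h1 := map_half_decomp hprime hd hp hp1 hdp hdq a
  have h2 := map_half_decomp (p := 1 - p) hprime hd (IsIdempotentElem.one_sub hp) (by simpa)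
    hdq (by simpa) a
  rw [halfJordan_sub_one, h1, show offDiag (1 - p) a = offDiag p a by
    simp only [offDiag, sub_sub_cancel]; abel] at h2
  linear_combination (norm := module) h2

lemma map_add_offDiag (hprime : ElementwisePrime A) (hd : IsHalfJordanDeriv d)
    (hp : p * p = p) (hp0 : p ≠ 0) (hp1 : p ≠ 1) (hdp : d p = 0) (hdq : d (1 - p) = 0) {s t : A}
    (hs : p * s + s * p = s) (ht : p * t + t * p = t) : d (s + t) = d s + d t := by
  have hst : p * (s + t) + (s + t) * p = s + t := by
    rw [mul_add, add_mul]; nth_rewrite 3 [← hs]; nth_rewrite 3 [← ht]; abel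
  have hqq : (1 - p) * (1 - p) = 1 - p := IsIdempotentElem.one_sub hp
  have e1 := map_corner_add_offDiag hprime hd hp hp1 hdp hdq hp hp hs
  have e2 := map_corner_add_offDiag (p := 1 - p) hprime hd hqq (by simpa) hdq (by simpa) hqq hqq
    (mem_offDiag_compl ht)
  have hc (x y : A) : halfJordan x y = halfJordan y x := by rw [halfJordan, halfJordan, add_comm]
  have hpq : halfJordan p (1 - p) = 0 := by
    rw [halfJordan, mul_sub, sub_mul, hp]; simp
  have hqp : halfJordan (1 - p) p = 0 := by rw [hc, hpq]
  have hds := map_mem_offDiag hd hdp hdq hs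
  have hdt := map_mem_offDiag hd hdp hdq ht
  have key := map_offDiag hd hp hdp hdq (halfJordan (p + s) (1 - p + t))
  rw [hd, e1, e2, hdp, hdq, zero_add, zero_add] at key
  simp only [halfJordan_add, add_halfJordan, offDiag_add, offDiag_halfJordan_mem hp hs ht,
    offDiag_halfJordan_mem hp hds ht, offDiag_halfJordan_mem hp hs hdt, hqp, zero_add, add_zero,
    halfJordan_of_mem ht, hc _ (1 - p), halfJordan_of_mem (mem_offDiag_compl hs),
    halfJordan_of_mem hdt, halfJordan_of_mem (mem_offDiag_compl hds),
    offDiag_of_mem hp (smul_mem_offDiag _ hs), offDiag_of_mem hp (smul_mem_offDiag _ ht),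
    offDiag_of_mem hp (smul_mem_offDiag _ hds), offDiag_of_mem hp (smul_mem_offDiag _ hdt)] at key
  rw [← smul_add, map_half_smul hd hdp hdq hst, ← smul_add] at key
  exact smul_right_injective A (by norm_num : (2⁻¹ : ℂ) ≠ 0) key

lemma map_add_corner (hprime : ElementwisePrime A) (hd : IsHalfJordanDeriv d)
    (hp : p * p = p) (hp0 : p ≠ 0) (hp1 : p ≠ 1) (hdp : d p = 0) (hdq : d (1 - p) = 0) (a b : A) :
    d (p * (a + b) * p) = d (p * a * p) + d (p * b * p) := by
  have l (x : A) : p * (p * x * p) = p * x * p := by simp only [← mul_assoc, hp]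
  have r (x : A) : p * x * p * p = p * x * p := by rw [mul_assoc, hp]
  have k (x : A) := map_corner hd hp hdp (l x) (r x)
  rw [← sub_eq_zero, ← sub_sub]
  refine eq_zero_of_halfJordan_offDiag hprime hp hp1 (by simp only [mul_sub, (k _).1])
      (by simp only [sub_mul, (k _).2]) fun t ht => ?_
  have hm (x : A) : p * halfJordan t (p * x * p) + halfJordan t (p * x * p) * p
      = halfJordan t (p * x * p) := by
    rw [← halfJordan_corner_mem hp (l x) (r x) ht]; exact offDiag_mem hp _
  have e := map_add_offDiag hprime hd hp hp0 hp1 hdp hdq (hm a) (hm b)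
  rw [← halfJordan_add, ← add_mul, ← mul_add, hd, hd, hd] at e
  simp only [mul_add, add_mul, halfJordan_add] at e
  have hs (x y : A) : halfJordan t (x - y) = halfJordan t x - halfJordan t y := by
    simp only [halfJordan, mul_sub, sub_mul]; module
  rw [hs, hs, mul_add, add_mul]
  linear_combination (norm := module) e

lemma map_add_of_normalised (hprime : ElementwisePrime A) (hd : IsHalfJordanDeriv d)
    (hp : p * p = p) (hp0 : p ≠ 0) (hp1 : p ≠ 1) (hdp : d p = 0) (hdq : d (1 - p) = 0) (a b : A) :
    d (a + b) = d a + d b := by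
  rw [map_peirce hprime hd hp hp0 hp1 hdp hdq (a + b), map_peirce hprime hd hp hp0 hp1 hdp hdq a,
    map_peirce hprime hd hp hp0 hp1 hdp hdq b, map_add_corner hprime hd hp hp0 hp1 hdp hdq,
    map_add_corner (p := 1 - p) hprime hd (IsIdempotentElem.one_sub hp)
      (sub_ne_zero.2 hp1.symm) (by simpa) hdq (by simpa), offDiag_add,
    map_add_offDiag hprime hd hp hp0 hp1 hdp hdq (offDiag_mem hp a) (offDiag_mem hp b)]
  abel

end Normalised

lemma IsHalfJordanDeriv.map_idem {d : A → A} (hd : IsHalfJordanDeriv d) {p : A}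
    (hp : p * p = p) : p * d p + d p * p = d p := by
  have h := hd p p
  simp only [halfJordan, hp] at h
  rw [show (2⁻¹ : ℂ) • (p + p) = p by module] at h
  nth_rewrite 3 [h]
  module

lemma IsHalfJordanDeriv.map_one_sub_idem {d : A → A} (hd : IsHalfJordanDeriv d) {p : A}
    (hp : p * p = p) : d (1 - p) = -d p := by
  have hqq : (1 - p) * (1 - p) = 1 - p := IsIdempotentElem.one_sub hp
  have h1 := mem_offDiag_compl (hd.map_idem hp)
  have h2 := mem_offDiag_compl (hd.map_idem hqq)
  rw [sub_sub_cancel] at h2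
  have hpq : halfJordan p (1 - p) = 0 := by
    rw [halfJordan, mul_sub, sub_mul, hp]; simp
  have h := hd p (1 - p)
  rw [hpq, hd.map_zero, halfJordan_of_mem h2, halfJordan, add_comm, add_comm (d p * _), h1,
    ← smul_add] at h
  have := (smul_eq_zero.1 h.symm).resolve_left (by norm_num)
  exact eq_neg_of_add_eq_zero_left this

lemma IsHalfJordanDeriv.sub_inner {d : A → A} (hd : IsHalfJordanDeriv d) (w : A) :
    IsHalfJordanDeriv fun x => d x - (w * x - x * w) := by
  intro x y
  simp only [hd x y]
  simp only [halfJordan, mul_smul_comm, smul_mul_assoc, mul_add, add_mul, mul_sub, sub_mul,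
    mul_assoc]
  module

/-- A multiplicative Jordan derivation of a prime algebra with a nontrivial idempotent
is additive. -/
theorem IsHalfJordanDeriv.map_add {d : A → A} {p : A} (hd : IsHalfJordanDeriv d)
    (hprime : ElementwisePrime A) (hp : p * p = p) (hp0 : p ≠ 0) (hp1 : p ≠ 1) (a b : A) :
    d (a + b) = d a + d b := by
  set w := (1 - p) * d p * p - p * d p * (1 - p) with hw
  have hwp : w * p - p * w = d p := by
    conv_rhs => rw [← offDiag_of_mem hp (hd.map_idem hp)]
    have h (x : A) : p * (p * x) = p * x := by rw [← mul_assoc, hp]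
    simp only [hw, offDiag, mul_sub, sub_mul, mul_one, one_mul, mul_assoc, hp, h]
    abel
  have hadd := map_add_of_normalised hprime (hd.sub_inner w) hp hp0 hp1
    (by rw [hwp, sub_self])
    (by rw [hd.map_one_sub_idem hp, ← hwp]; noncomm_ring) a b
  simp only [mul_add, add_mul] at hadd
  linear_combination (norm := module) hadd

lemma ElementwisePrime.eq_zero_or_of_mul_add {a b : A} (hprime : ElementwisePrime A)
    (h : ∀ x, a * x * b + b * x * a = 0) : a = 0 ∨ b = 0 := by
  refine hprime a b fun x => ?_
  refine or_self_iff.1 (hprime _ _ fun y => ?_)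
  have h1 := congrArg (· * (y * a * x * b)) (h x)
  have h2 := congrArg (b * x * ·) (h (y * a * x))
  have h3 := h (x * b * y * a * x)
  have h4 : (2 : ℂ) • (a * x * b * y * (a * x * b)) = 0 := by
    simp only [add_mul, mul_add, mul_assoc, zero_mul, mul_zero] at h1 h2 h3 ⊢
    linear_combination (norm := module) h1 - h2 + h3
  exact (smul_eq_zero.1 h4).resolve_left two_ne_zero

/-- Herstein's theorem: an additive Jordan derivation of a noncommutative prime algebra is a
derivation. -/
theorem map_mul_of_jordan_deriv {d : A → A} (hprime : ElementwisePrime A)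
    (hnc : ∃ x y : A, x * y ≠ y * x) (hadd : ∀ x y, d (x + y) = d x + d y)
    (hj : ∀ x y, d (x * y + y * x) = d x * y + y * d x + (x * d y + d y * x)) (x y : A) :
    d (x * y) = d x * y + x * d y := by
  have two_inj {u v : A} (h : u + u = v + v) : u = v := by
    rw [← two_smul ℂ, ← two_smul ℂ] at h
    exact smul_right_injective A two_ne_zero h
  have triple (x y : A) : d (x * y * x) = d x * y * x + x * d y * x + x * y * d x := by
    have h1 := hj x (x * y + y * x)
    have h2 := hj (x * x) y
    have h3 : d (x * x) = d x * x + x * d x := by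
      have := hj x x
      rw [hadd] at this
      apply two_inj
      rw [this]; abel
    rw [hj x y] at h1
    rw [h3] at h2
    simp only [hadd, mul_add, add_mul, mul_assoc] at h1 h2 ⊢
    apply two_inj
    linear_combination (norm := module) h1 - h2
  have triple' (x y z : A) : d (x * y * z) + d (z * y * x) = d x * y * z + x * d y * z
      + x * y * d z + (d z * y * x + z * d y * x + z * y * d x) := by
    have h := triple (x + z) y
    have h1 := triple x y
    have h2 := triple z y
    simp only [hadd, mul_add, add_mul] at h h1 h2 ⊢
    linear_combination (norm := module) h - h1 - h2
  have key (a b : A) : d (a * b) - d a * b - a * d b = 0 ∨ a * b - b * a = 0 := by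
    refine hprime.eq_zero_or_of_mul_add fun x => ?_
    have h1 := triple' (a * b) x (b * a)
    have h2 := triple a (b * x * b)
    have h3 := triple b (a * x * a)
    rw [triple b x] at h2
    rw [triple a x] at h3
    have h4 := hj a b
    rw [hadd] at h4
    have h5 : d (b * a) = d a * b + b * d a + (a * d b + d b * a) - d (a * b) :=
      eq_sub_of_add_eq' h4
    rw [h5] at h1
    simp only [mul_add, add_mul, mul_sub, sub_mul, mul_assoc] at h1 h2 h3 ⊢
    linear_combination (norm := module) h1 - h2 - h3
  have step (a : A) := forall_or_forall_of_add (fun b => d (a * b) - d a * b - a * d b)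
    (fun b => a * b - b * a) (fun u v => by simp only [mul_add, hadd]; abel)
    (fun u v => by simp only [mul_add, add_mul]; abel) (key a)
  have fin := forall_or_forall_of_add (fun a b => d (a * b) - d a * b - a * d b)
    (fun a b => a * b - b * a)
    (fun u v => by funext b; simp only [add_mul, hadd, Pi.add_apply]; abel)
    (fun u v => by funext b; simp only [mul_add, add_mul, Pi.add_apply]; abel)
    (fun a => (step a).imp funext funext)
  rcases fin with h | h
  · have := congrFun (h x) y
    simp only [Pi.zero_apply] at this
    rw [sub_sub] at this
    exact sub_eq_zero.1 this
  · obtain ⟨u, v, huv⟩ := hnc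
    exact absurd (sub_eq_zero.1 (congrFun (h u) v)) huv

theorem IsHalfJordanDeriv.map_mul {d : A → A} {p : A} (hd : IsHalfJordanDeriv d)
    (hprime : ElementwisePrime A) (hp : p * p = p) (hp0 : p ≠ 0) (hp1 : p ≠ 1) (a b : A) :
    d (a * b) = d a * b + a * d b := by
  have hadd := hd.map_add hprime hp hp0 hp1
  have hnc : ∃ x y : A, x * y ≠ y * x := by
    by_contra! hc
    rcases hprime p (1 - p) fun x => by
      rw [hc p x, mul_assoc, mul_sub, hp, mul_one, sub_self, mul_zero] with h | h
    · exact hp0 h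
    · exact hp1 (sub_eq_zero.1 h).symm
  refine map_mul_of_jordan_deriv hprime hnc hadd (fun x y => ?_) a b
  rw [show x * y + y * x = halfJordan x y + halfJordan x y by rw [halfJordan]; module, hadd, hd]
  simp only [halfJordan]
  module

end PrimeAlgebra

section JordanProd

variable {A : Type*} [Ring A] [Algebra ℂ A]

lemma foldl_replicate_one (k : ℕ) (x : A) :
    (List.replicate k (1 : A)).foldl (fun x y => x * y + y * x) x = (2 : ℂ) ^ k • x := by
  induction k generalizing x with
  | zero => simp
  | succ k ih =>
    rw [List.replicate_succ, List.foldl_cons, ih, mul_one, one_mul, pow_succ]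
    module

lemma sum_foldl_replicate_one_set (k : ℕ) (x z : A) :
    ∑ i ∈ Finset.range k,
      ((List.replicate k (1 : A)).set i z).foldl (fun x y => x * y + y * x) x
      = (k * 2 ^ k / 2 : ℂ) • (x * z + z * x) := by
  induction k generalizing x with
  | zero => simp
  | succ k ih =>
    rw [Finset.sum_range_succ']
    simp only [List.replicate_succ, List.set_cons_succ, List.set_cons_zero, List.foldl_cons, ih,
      foldl_replicate_one, mul_one, one_mul, add_mul, mul_add, pow_succ]
    push_cast
    module

/-- The identity obtained from a multiplicative Jordan `(k + 2)`-derivation by evaluating at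
`(a, b, 1, …, 1)`. -/
lemma IsMulJordanDeriv.map_two_pow_smul {k : ℕ} {D : A → A} (hD : IsMulJordanDeriv (k + 2) D)
    (a b : A) :
    D ((2 : ℂ) ^ k • (a * b + b * a)) = (2 : ℂ) ^ k • (D a * b + b * D a)
      + (2 : ℂ) ^ k • (a * D b + D b * a)
      + (k * 2 ^ k / 2 : ℂ) • ((a * b + b * a) * D 1 + D 1 * (a * b + b * a)) := by
  have h := hD (a :: b :: List.replicate k 1) (by simp)
  rw [Finset.sum_range_succ', Finset.sum_range_succ'] at h
  simp only [jordanProd, List.foldl_cons, foldl_replicate_one, List.set_cons_succ,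
    List.set_cons_zero, List.getD_cons_succ, List.getD_cons_zero] at h
  rw [h, Finset.sum_congr rfl fun i hi => by
    rw [List.getD_replicate _ (Finset.mem_range.1 hi)], sum_foldl_replicate_one_set]
  abel

/-- The difference of a generalized Jordan derivation and its associated Jordan derivation is
a Jordan centralizer, here evaluated at `(a, b, 1, …, 1)`. -/
lemma IsMulGenJordanDeriv.sub_map_two_pow_smul {k : ℕ} {F D : A → A}
    (hD : IsMulJordanDeriv (k + 2) D) (hF : IsMulGenJordanDeriv (k + 2) F D) (a b : A) :
    F ((2 : ℂ) ^ k • (a * b + b * a)) - D ((2 : ℂ) ^ k • (a * b + b * a))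
      = (2 : ℂ) ^ k • ((F a - D a) * b + b * (F a - D a)) := by
  have h1 := hD (a :: b :: List.replicate k 1) (by simp)
  have h2 := hF (a :: b :: List.replicate k 1) (by simp)
  rw [Finset.range_eq_Ico, Finset.sum_eq_sum_Ico_succ_bot (by omega)] at h1
  have h3 := congrArg₂ (· - ·) h2 h1
  simp only [zero_add, add_sub_add_right_eq_sub] at h3
  simp only [jordanProd, List.foldl_cons, foldl_replicate_one,
    List.set_cons_zero, List.getD_cons_zero] at h3
  rw [h3, sub_mul, mul_sub]
  module

lemma two_pow_smul_injective (k : ℕ) : Function.Injective fun x : A => (2 : ℂ) ^ k • x :=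
  smul_right_injective A (pow_ne_zero k two_ne_zero)

lemma IsMulJordanDeriv.map_halfJordan {k : ℕ} {D : A → A} (hD : IsMulJordanDeriv (k + 2) D)
    (a b : A) :
    D (halfJordan a b) = halfJordan (D a) b + halfJordan a (D b)
      - halfJordan (halfJordan a b) (D 1) := by
  have h1 := hD.map_two_pow_smul a b
  have h2 := hD.map_two_pow_smul (halfJordan a b) 1
  have h3 : halfJordan a b * 1 + 1 * halfJordan a b = a * b + b * a := by
    rw [halfJordan]; simp only [mul_one, one_mul]; module
  rw [h3, h1] at h2
  apply two_pow_smul_injective k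
  apply two_pow_smul_injective 1
  simp only [halfJordan, mul_smul_comm, smul_mul_assoc, mul_one, one_mul] at h2 ⊢
  linear_combination (norm := module) -h2

lemma IsMulJordanDeriv.commute_map_one_of_idem {k : ℕ} {D : A → A}
    (hD : IsMulJordanDeriv (k + 2) D) (p : A) (hp : p * p = p) : p * D 1 = D 1 * p := by
  have h := hD.map_halfJordan p p
  have hpp : halfJordan p p = p := by rw [halfJordan, hp]; module
  have l (x : A) : p * (p * x) = p * x := by rw [← mul_assoc, hp]
  rw [hpp] at h
  have h1 := congrArg (fun x => p * x * (1 - p)) h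
  have h2 := congrArg (fun x => (1 - p) * x * p) h
  simp only [halfJordan, mul_smul_comm, smul_mul_assoc, mul_add, add_mul, mul_sub, sub_mul,
    mul_one, one_mul, mul_assoc, hp, l] at h1 h2
  linear_combination (norm := module) (2 : ℂ) • h1 - (2 : ℂ) • h2

/-- Multiplicative generalized Jordan derivations of a prime algebra with a nontrivial idempotent
are sums of a central multiplication and a derivation. -/
theorem exists_central_add_deriv {p : A} (hprime : ElementwisePrime A) (hp : p * p = p)
    (hp0 : p ≠ 0) (hp1 : p ≠ 1) {k : ℕ} {F D : A → A} (hD : IsMulJordanDeriv (k + 2) D)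
    (hF : IsMulGenJordanDeriv (k + 2) F D) :
    ∃ μ : A, ∃ δ : A → A,
      (∀ a : A, μ * a = a * μ) ∧
      (∀ x y : A, δ (x + y) = δ x + δ y) ∧
      (∀ x y : A, δ (x * y) = δ x * y + x * δ y) ∧
      ∀ t : A, F t = μ * t + δ t := by
  have hz := hprime.mul_comm_of_idem hp hp0 hp1 hD.commute_map_one_of_idem
  have hd : IsHalfJordanDeriv fun x => D x - D 1 * x := by
    intro x y
    have h (x y : A) : x * (D 1 * y) = D 1 * (x * y) := by rw [← mul_assoc, ← hz, mul_assoc]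
    simp only [hD.map_halfJordan x y]
    simp only [halfJordan, mul_smul_comm, mul_add, mul_sub, sub_mul, mul_assoc, h, ← hz]
    module
  obtain ⟨c, hc⟩ : ∃ c, c = F 1 - D 1 := ⟨_, rfl⟩
  have hG (a : A) : F a - D a = halfJordan c a := by
    have h1 := hF.sub_map_two_pow_smul hD a 1
    have h2 := hF.sub_map_two_pow_smul hD 1 a
    rw [add_comm (1 * a), h1, mul_one, one_mul] at h2
    have h3 := two_pow_smul_injective k h2
    rw [halfJordan, hc]
    linear_combination (norm := module) (2⁻¹ : ℂ) • h3
  have hcomm (a b : A) : (c * b - b * c) * a = a * (c * b - b * c) := by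
    have h := hF.sub_map_two_pow_smul hD a b
    rw [hG, hG] at h
    have h1 : halfJordan c ((2 : ℂ) ^ k • (a * b + b * a))
        = (2 : ℂ) ^ k • halfJordan c (a * b + b * a) := by
      simp only [halfJordan, mul_smul_comm, smul_mul_assoc]; module
    rw [h1] at h
    have h2 := two_pow_smul_injective k h
    simp only [halfJordan, mul_smul_comm, smul_mul_assoc, mul_add, add_mul, mul_sub, sub_mul,
      mul_assoc] at h2 ⊢
    linear_combination (norm := module) (2 : ℂ) • h2
  have hcc (b : A) : c * b = b * c := by
    rw [← sub_eq_zero]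
    refine or_self_iff.1 (hprime _ _ fun x => ?_)
    have h1 := hcomm b (c * b)
    have h2 : c * (c * b) - c * b * c = c * (c * b - b * c) := by
      rw [mul_sub, mul_assoc]
    rw [h2, mul_assoc, hcomm b b, ← mul_assoc, ← mul_assoc, ← sub_eq_zero, ← sub_mul] at h1
    rw [mul_assoc, ← hcomm x b, ← mul_assoc, h1, zero_mul]
  refine ⟨c + D 1, fun x => D x - D 1 * x, fun a => by rw [add_mul, mul_add, hcc, hz],
    hd.map_add hprime hp hp0 hp1, hd.map_mul hprime hp hp0 hp1, fun t => ?_⟩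
  have h := hG t
  rw [halfJordan, ← hcc t, show (2⁻¹ : ℂ) • (c * t + c * t) = c * t by module] at h
  change F t = (c + D 1) * t + (D t - D 1 * t)
  rw [add_mul, ← h]
  abel

end JordanProd

section StandardOperatorAlgebra

variable {X : Type*} [NormedAddCommGroup X] [NormedSpace ℂ X]

lemma finiteDimensional_range_smulRight (f : X →L[ℂ] ℂ) (u : X) :
    FiniteDimensional ℂ (LinearMap.range ((f.smulRight u : X →L[ℂ] X) : X →ₗ[ℂ] X)) := by
  refine Submodule.finiteDimensional_of_le (S₂ := Submodule.span ℂ {u}) ?_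
  rintro _ ⟨x, rfl⟩
  exact Submodule.smul_mem _ _ (Submodule.mem_span_singleton_self u)

lemma elementwisePrime_of_finiteRank_mem (𝒜 : Subalgebra ℂ (X →L[ℂ] X))
    (hfinrank : ∀ T : X →L[ℂ] X,
      FiniteDimensional ℂ (LinearMap.range (T : X →ₗ[ℂ] X)) → T ∈ 𝒜) :
    ElementwisePrime 𝒜 := by
  intro a b h
  by_contra! hab
  obtain ⟨u, hu⟩ : ∃ u, (a : X →L[ℂ] X) u ≠ 0 := by
    by_contra! hc
    exact hab.1 (Subtype.ext (ContinuousLinearMap.ext hc))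
  obtain ⟨v, hv⟩ : ∃ v, (b : X →L[ℂ] X) v ≠ 0 := by
    by_contra! hc
    exact hab.2 (Subtype.ext (ContinuousLinearMap.ext hc))
  obtain ⟨f, hf⟩ := SeparatingDual.exists_eq_one (R := ℂ) hv
  have h1 := h ⟨f.smulRight u, hfinrank _ (finiteDimensional_range_smulRight f u)⟩
  have h2 := DFunLike.congr_fun (congrArg Subtype.val h1) v
  simp [hf] at h2
  exact hu h2

lemma exists_nontrivial_idem (hdim : 1 < Module.rank ℂ X) (𝒜 : Subalgebra ℂ (X →L[ℂ] X))
    (hfinrank : ∀ T : X →L[ℂ] X,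
      FiniteDimensional ℂ (LinearMap.range (T : X →ₗ[ℂ] X)) → T ∈ 𝒜) :
    ∃ p : 𝒜, p * p = p ∧ p ≠ 0 ∧ p ≠ 1 := by
  have : Nontrivial X := by
    rw [← rank_pos_iff_nontrivial (R := ℂ)]
    exact zero_lt_one.trans hdim
  obtain ⟨u, hu⟩ := exists_ne (0 : X)
  obtain ⟨f, hf⟩ := SeparatingDual.exists_eq_one (R := ℂ) hu
  refine ⟨⟨f.smulRight u, hfinrank _ (finiteDimensional_range_smulRight f u)⟩, ?_, ?_, ?_⟩
  · ext x
    simp [hf]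
  · intro h
    have := DFunLike.congr_fun (congrArg Subtype.val h) u
    simp [hf] at this
    exact hu this
  · intro h
    refine hdim.not_ge (rank_le_one_iff.2 ⟨u, fun x => ⟨f x, ?_⟩⟩)
    exact DFunLike.congr_fun (congrArg Subtype.val h) x

end StandardOperatorAlgebra

/-- Every multiplicative generalized Jordan `n`-derivation of a standard operator
algebra `𝒜` on a complex Banach space `X` of dimension greater than `1` (a subalgebra
of `B(X)` containing the identity and all bounded finite-rank operators) has the form
`Δ(t) = μt + δ(t)` with `μ` central and `δ` a derivation. -/
theorem stmt_10 (n : ℕ) (hn : 2 ≤ n)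
    (X : Type*) [NormedAddCommGroup X] [NormedSpace ℂ X] [CompleteSpace X]
    (hdim : 1 < Module.rank ℂ X)
    (𝒜 : Subalgebra ℂ (X →L[ℂ] X))
    (hfinrank : ∀ T : X →L[ℂ] X,
      FiniteDimensional ℂ (LinearMap.range (T : X →ₗ[ℂ] X)) → T ∈ 𝒜)
    (Δ δ₀ : 𝒜 → 𝒜) (hδ₀ : IsMulJordanDeriv n δ₀) (hΔ : IsMulGenJordanDeriv n Δ δ₀) :
    ∃ μ : 𝒜, ∃ δ : 𝒜 → 𝒜,
      (∀ a : 𝒜, μ * a = a * μ) ∧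
      (∀ x y : 𝒜, δ (x + y) = δ x + δ y) ∧
      (∀ x y : 𝒜, δ (x * y) = δ x * y + x * δ y) ∧
      ∀ t : 𝒜, Δ t = μ * t + δ t := by
  obtain ⟨k, rfl⟩ := Nat.exists_eq_add_of_le' hn
  obtain ⟨p, hp, hp0, hp1⟩ := exists_nontrivial_idem hdim 𝒜 hfinrank
  exact exists_central_add_deriv (elementwisePrime_of_finiteRank_mem 𝒜 hfinrank) hp hp0 hp1
    hδ₀ hΔ
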